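/- 𝓜_{A₁}(ℝ^n) = 𝓜_{A_∞^F}(ℝ^n); that is, a measurable function on ℝ^n has an A₁(ℝ^n) majorant if and only if it is majorized a.e. by a weight w ∈ A_∞(ℝ^n) satisfying Mw < ∞ a.e. -/

import Mathlib

open MeasureTheory ENNReal

/-- A (nondegenerate) cube in `ℝⁿ` with sides parallel to the axes. -/
def IsCube {n : ℕ} (Q : Set (Fin n → ℝ)) : Prop :=
  ∃ (a : Fin n → ℝ) (l : ℝ), 0 < l ∧
    Q = Set.univ.pi fun i => Set.Icc (a i) (a i + l)

/-- The domains considered: all of `ℝⁿ` or a cube with sides parallel to the axes. -/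
def IsAdmissibleDomain {n : ℕ} (Ω : Set (Fin n → ℝ)) : Prop :=
  Ω = Set.univ ∨ IsCube Ω

/-- The Hardy–Littlewood maximal operator restricted to `Ω`:
`M_Ω f (x) = sup { (1/|Q|) ∫_Q |f| : Q ⊆ Ω a cube with x ∈ Q }`. -/
noncomputable def maximal {n : ℕ} (Ω : Set (Fin n → ℝ)) (f : (Fin n → ℝ) → ℝ)
    (x : Fin n → ℝ) : ℝ≥0∞ :=
  ⨆ (Q : Set (Fin n → ℝ)) (_ : IsCube Q) (_ : Q ⊆ Ω) (_ : x ∈ Q),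
    (volume Q)⁻¹ * ∫⁻ y in Q, ENNReal.ofReal |f y|

/-- A weight on `Ω`: a measurable function, positive a.e. on `Ω`, integrable on every
cube contained in `Ω` (hence locally integrable; integrable when `Ω` is itself a cube). -/
structure IsWeight {n : ℕ} (Ω : Set (Fin n → ℝ)) (w : (Fin n → ℝ) → ℝ) : Prop where
  measurable : Measurable w
  pos : ∀ᵐ x ∂(volume.restrict Ω), 0 < w x
  locInt : ∀ Q : Set (Fin n → ℝ), IsCube Q → Q ⊆ Ω → IntegrableOn w Q

/-- The Muckenhoupt `A₁(Ω)` class: `M_Ω w ≤ C w` a.e. on `Ω`. -/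
def MemA1 {n : ℕ} (Ω : Set (Fin n → ℝ)) (w : (Fin n → ℝ) → ℝ) : Prop :=
  IsWeight Ω w ∧ ∃ C : ℝ, ∀ᵐ x ∂(volume.restrict Ω),
    maximal Ω w x ≤ ENNReal.ofReal (C * w x)

/-- The Muckenhoupt `A_p(Ω)` class for `1 < p < ∞`:
`sup_{Q ⊆ Ω} (avg_Q w) * (avg_Q w^(1-p'))^(p-1) < ∞` where `p' = p/(p-1)`. -/
def MemApGT1 {n : ℕ} (Ω : Set (Fin n → ℝ)) (p : ℝ) (w : (Fin n → ℝ) → ℝ) : Prop :=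
  IsWeight Ω w ∧ ∃ C : ℝ≥0∞, C ≠ ∞ ∧ ∀ Q : Set (Fin n → ℝ), IsCube Q → Q ⊆ Ω →
    ((volume Q)⁻¹ * ∫⁻ x in Q, ENNReal.ofReal (w x)) *
      ((volume Q)⁻¹ * ∫⁻ x in Q, ENNReal.ofReal (w x ^ (1 - p / (p - 1)))) ^ (p - 1) ≤ C

/-- The Muckenhoupt `A_p(Ω)` class for `1 ≤ p < ∞`. -/
def MemA {n : ℕ} (Ω : Set (Fin n → ℝ)) (p : ℝ) (w : (Fin n → ℝ) → ℝ) : Prop :=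
  (p = 1 ∧ MemA1 Ω w) ∨ (1 < p ∧ MemApGT1 Ω p w)

/-- The Muckenhoupt `A_∞(Ω)` class: the union of `A_p(Ω)` over `1 ≤ p < ∞`. -/
def MemAInf {n : ℕ} (Ω : Set (Fin n → ℝ)) (w : (Fin n → ℝ) → ℝ) : Prop :=
  ∃ p : ℝ, 1 ≤ p ∧ MemA Ω p w

/-- Membership in the weighted Lebesgue space `L^p_w(Ω)`: `f` measurable with
`∫_Ω |f|^p w < ∞`. -/
def MemLw {n : ℕ} (Ω : Set (Fin n → ℝ)) (p : ℝ) (w f : (Fin n → ℝ) → ℝ) : Prop :=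
  Measurable f ∧
    ∫⁻ x in Ω, ENNReal.ofReal |f x| ^ p * ENNReal.ofReal (w x) < ⊤

/-- Membership in the (unweighted) Lebesgue space `L^p(Ω)`. -/
def MemLeb {n : ℕ} (Ω : Set (Fin n → ℝ)) (p : ℝ) (f : (Fin n → ℝ) → ℝ) : Prop :=
  MemLw Ω p (fun _ => 1) f

/-- `f ∈ 𝓜_{A_p}(Ω)`: `f` is measurable and `|f| ≤ w` a.e. on `Ω` for some `w ∈ A_p(Ω)`. -/
def HasApMajorant {n : ℕ} (Ω : Set (Fin n → ℝ)) (p : ℝ) (f : (Fin n → ℝ) → ℝ) : Prop :=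
  Measurable f ∧ ∃ w, MemA Ω p w ∧ ∀ᵐ x ∂(volume.restrict Ω), |f x| ≤ w x

/-- `f ∈ 𝓜^r_{A_p}(Ω)`: `f` is measurable and `|f|^r ≤ w` a.e. on `Ω` for some
`w ∈ A_p(Ω)`. -/
def HasApPowMajorant {n : ℕ} (Ω : Set (Fin n → ℝ)) (p r : ℝ) (f : (Fin n → ℝ) → ℝ) : Prop :=
  Measurable f ∧ ∃ w, MemA Ω p w ∧ ∀ᵐ x ∂(volume.restrict Ω), |f x| ^ r ≤ w x

/-- `f ∈ 𝓜_{A_∞}(Ω)`: `f` is measurable and `|f| ≤ w` a.e. on `Ω` for some `w ∈ A_∞(Ω)`. -/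
def HasAInfMajorant {n : ℕ} (Ω : Set (Fin n → ℝ)) (f : (Fin n → ℝ) → ℝ) : Prop :=
  Measurable f ∧ ∃ w, MemAInf Ω w ∧ ∀ᵐ x ∂(volume.restrict Ω), |f x| ≤ w x

/-- Membership in weak `L^p(ℝⁿ)`: `sup_{t>0} t · |{|f| > t}|^{1/p} < ∞`. -/
def MemWeakLp {n : ℕ} (p : ℝ) (f : (Fin n → ℝ) → ℝ) : Prop :=
  Measurable f ∧ ∃ C : ℝ≥0∞, C ≠ ⊤ ∧ ∀ t : ℝ, 0 < t →
    ENNReal.ofReal t * volume {x | t < |f x|} ^ (1 / p) ≤ C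

section MaximalInequality

variable {n : ℕ}

theorem volume_closedBall_mul (c c' : Fin n → ℝ) {k r : ℝ} (hk : 0 ≤ k) (hr : 0 ≤ r) :
    volume (Metric.closedBall c (k * r)) =
      ENNReal.ofReal k ^ n * volume (Metric.closedBall c' r) := by
  rw [Real.volume_pi_closedBall _ (mul_nonneg hk hr), Real.volume_pi_closedBall _ hr,
    ← ENNReal.ofReal_pow hk, ← ENNReal.ofReal_mul (by positivity), Fintype.card_fin, ← mul_pow]
  ring_nf

theorem volume_closedBall_ne_zero (c : Fin n → ℝ) {r : ℝ} (hr : 0 < r) :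
    volume (Metric.closedBall c r) ≠ 0 :=
  (Metric.measure_closedBall_pos volume c hr).ne'

theorem volume_closedBall_ne_top (c : Fin n → ℝ) (r : ℝ) :
    volume (Metric.closedBall c r) ≠ ∞ :=
  measure_closedBall_lt_top.ne

/-- The mean value of `f` over the closed sup-norm ball of center `c` and radius `r`. -/
noncomputable def ballAvg (f : (Fin n → ℝ) → ℝ≥0∞) (c : Fin n → ℝ) (r : ℝ) : ℝ≥0∞ :=
  (volume (Metric.closedBall c r))⁻¹ * ∫⁻ y in Metric.closedBall c r, f y

theorem volume_mul_ballAvg (f : (Fin n → ℝ) → ℝ≥0∞) (c : Fin n → ℝ) {r : ℝ} (hr : 0 < r) :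
    volume (Metric.closedBall c r) * ballAvg f c r = ∫⁻ y in Metric.closedBall c r, f y := by
  rw [ballAvg, ← mul_assoc, ENNReal.mul_inv_cancel (volume_closedBall_ne_zero c hr)
    (volume_closedBall_ne_top c r), one_mul]

/-- The uncentered maximal function over sup-norm balls with radii in `S`. -/
noncomputable def ballMax (S : Set ℝ) (f : (Fin n → ℝ) → ℝ≥0∞) (x : Fin n → ℝ) : ℝ≥0∞ :=
  ⨆ (c : Fin n → ℝ) (r : ℝ) (_ : r ∈ S) (_ : 0 < r) (_ : x ∈ Metric.ball c r), ballAvg f c r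

theorem lt_ballMax_iff {S : Set ℝ} {f : (Fin n → ℝ) → ℝ≥0∞} {x : Fin n → ℝ} {t : ℝ≥0∞} :
    t < ballMax S f x ↔
      ∃ c, ∃ r ∈ S, 0 < r ∧ x ∈ Metric.ball c r ∧ t < ballAvg f c r := by
  simp only [ballMax, lt_iSup_iff, exists_prop]

theorem ballMax_le_iff {S : Set ℝ} {f : (Fin n → ℝ) → ℝ≥0∞} {x : Fin n → ℝ} {t : ℝ≥0∞} :
    ballMax S f x ≤ t ↔
      ∀ c, ∀ r ∈ S, 0 < r → x ∈ Metric.ball c r → ballAvg f c r ≤ t := by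
  simp only [ballMax, iSup_le_iff]

theorem ballAvg_le_ballMax {S : Set ℝ} (f : (Fin n → ℝ) → ℝ≥0∞) {x c : Fin n → ℝ} {r : ℝ}
    (hS : r ∈ S) (hr : 0 < r) (hx : x ∈ Metric.ball c r) : ballAvg f c r ≤ ballMax S f x :=
  ballMax_le_iff.1 le_rfl c r hS hr hx

theorem measurable_ballMax (S : Set ℝ) (f : (Fin n → ℝ) → ℝ≥0∞) : Measurable (ballMax S f) := by
  refine measurable_of_Ioi fun t => IsOpen.measurableSet ?_
  refine Metric.isOpen_iff.2 fun x hx => ?_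
  obtain ⟨c, r, hS, hr, hxc, ht⟩ := lt_ballMax_iff.1 (Set.mem_Ioi.1 hx)
  obtain ⟨ε, hε, h⟩ := Metric.isOpen_iff.1 Metric.isOpen_ball x hxc
  exact ⟨ε, hε, fun y hy => lt_ballMax_iff.2 ⟨c, r, hS, hr, h hy, ht⟩⟩

/-- The weak type `(1, 1)` inequality for the maximal function with bounded radii. -/
theorem mul_volume_lt_ballMax_le {S : Set ℝ} {R : ℝ} (hS : ∀ r ∈ S, r ≤ R)
    (f : (Fin n → ℝ) → ℝ≥0∞) (t : ℝ≥0∞) :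
    t * volume {x | t < ballMax S f x} ≤ 5 ^ n * ∫⁻ x, f x := by
  let T : Set ((Fin n → ℝ) × ℝ) := {q | q.2 ∈ S ∧ 0 < q.2 ∧ t < ballAvg f q.1 q.2}
  obtain ⟨u, huT, hdisj, hcov⟩ :=
    Vitali.exists_disjoint_subfamily_covering_enlargement_closedBall T Prod.fst Prod.snd R
      (fun a ha => hS _ ha.1) 5 (by norm_num)
  have hcount : u.Countable := hdisj.countable_of_nonempty_interior fun a ha =>
    ⟨a.1, Metric.ball_subset_interior_closedBall (Metric.mem_ball_self (huT ha).2.1)⟩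
  have hsub : {x | t < ballMax S f x} ⊆ ⋃ a ∈ u, Metric.closedBall a.1 (5 * a.2) := by
    intro x hx
    obtain ⟨c, r, hrS, hr, hxc, ht⟩ := lt_ballMax_iff.1 hx
    obtain ⟨b, hb, hsub⟩ := hcov (c, r) ⟨hrS, hr, ht⟩
    exact Set.mem_biUnion hb (hsub (Metric.ball_subset_closedBall hxc))
  have := hcount.to_subtype
  calc t * volume {x | t < ballMax S f x}
      ≤ t * ∑' a : u, volume (Metric.closedBall a.1.1 (5 * a.1.2)) := by
        gcongr
        exact (measure_mono hsub).trans (measure_biUnion_le _ hcount _)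
    _ = ∑' a : u, t * volume (Metric.closedBall a.1.1 (5 * a.1.2)) := ENNReal.tsum_mul_left.symm
    _ ≤ ∑' a : u, 5 ^ n * ∫⁻ y in Metric.closedBall a.1.1 a.1.2, f y := by
        refine ENNReal.tsum_le_tsum fun a => ?_
        obtain ⟨-, hr, ht⟩ := huT a.2
        rw [volume_closedBall_mul a.1.1 a.1.1 (by norm_num) hr.le, ← volume_mul_ballAvg f _ hr,
          ENNReal.ofReal_ofNat, mul_left_comm, mul_comm t]
        gcongr
    _ = 5 ^ n * ∫⁻ y in ⋃ a ∈ u, Metric.closedBall a.1 a.2, f y := by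
        rw [ENNReal.tsum_mul_left, lintegral_biUnion hcount
          (fun _ _ => Metric.isClosed_closedBall.measurableSet) hdisj]
    _ ≤ 5 ^ n * ∫⁻ x, f x := by
        gcongr
        exact Measure.restrict_le_self

theorem ballMax_le_ballMax_indicator_add (S : Set ℝ) (f : (Fin n → ℝ) → ℝ≥0∞)
    (s : ℝ≥0∞) (x : Fin n → ℝ) :
    ballMax S f x ≤ ballMax S ({y | s < f y}.indicator f) x + s := by
  refine ballMax_le_iff.2 fun c r hS hr hx => ?_
  refine le_trans ?_ (add_le_add_left (ballAvg_le_ballMax _ hS hr hx) s)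
  have hle : ∫⁻ y in Metric.closedBall c r, f y ≤
      (∫⁻ y in Metric.closedBall c r, {y | s < f y}.indicator f y) +
        s * volume (Metric.closedBall c r) := by
    rw [← setLIntegral_const, ← lintegral_add_right _ measurable_const]
    refine lintegral_mono fun y => ?_
    by_cases h : s < f y
    · simp [Set.indicator, h]
    · exact (not_lt.1 h).trans le_add_self
  calc ballAvg f c r ≤ (volume (Metric.closedBall c r))⁻¹ * _ := mul_le_mul_right hle _
    _ = _ := by
      rw [mul_add, mul_comm s, ← mul_assoc, ENNReal.inv_mul_cancel
        (volume_closedBall_ne_zero c hr) (volume_closedBall_ne_top c r), one_mul]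
      rfl

theorem ENNReal.sq_le_lintegral_indicator_Ioi (u : ℝ≥0∞) :
    u ^ 2 ≤ ∫⁻ t in Set.Ioi (0 : ℝ),
      {t : ℝ | ENNReal.ofReal t < u}.indicator (fun t => ENNReal.ofReal (2 * t)) t := by
  have key : ∀ a : ℝ, 0 ≤ a → ENNReal.ofReal a ≤ u → ENNReal.ofReal a ^ 2 ≤
      ∫⁻ t in Set.Ioi (0 : ℝ),
        {t : ℝ | ENNReal.ofReal t < u}.indicator (fun t => ENNReal.ofReal (2 * t)) t := by
    intro a ha hau
    have h1 : ENNReal.ofReal a ^ 2 = ∫⁻ t in Set.Ioo 0 a, ENNReal.ofReal (2 * t) := by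
      rw [restrict_Ioo_eq_restrict_Ioc, ← ofReal_integral_eq_lintegral_ofReal,
        ← intervalIntegral.integral_of_le ha, intervalIntegral.integral_const_mul, integral_id,
        ← ENNReal.ofReal_pow ha]
      · ring_nf
      · exact (Continuous.integrableOn_Icc (by fun_prop)).mono_set Set.Ioc_subset_Icc_self
      · filter_upwards [ae_restrict_mem measurableSet_Ioc] with t ht
        simpa using ht.1.le
    rw [h1]
    calc ∫⁻ t in Set.Ioo 0 a, ENNReal.ofReal (2 * t) ≤ ∫⁻ t in Set.Ioo 0 a,
          {t : ℝ | ENNReal.ofReal t < u}.indicator (fun t => ENNReal.ofReal (2 * t)) t := by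
          refine setLIntegral_mono' measurableSet_Ioo fun t ht => ?_
          rw [Set.indicator_of_mem]
          exact ((ENNReal.ofReal_lt_ofReal_iff (ht.1.trans ht.2)).2 ht.2).trans_le hau
      _ ≤ _ := lintegral_mono_set Set.Ioo_subset_Ioi_self
  rcases eq_or_ne u ∞ with rfl | hu
  · refine le_of_le_of_eq le_top (Eq.symm ?_)
    refine ENNReal.eq_top_of_forall_nnreal_le fun r => ?_
    refine le_trans ?_ (key (r + 1) (by positivity) le_top)
    have h : (1 : ℝ≥0∞) ≤ ENNReal.ofReal (r + 1) := by
      rw [ENNReal.one_le_ofReal]; simp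
    calc (r : ℝ≥0∞) ≤ ENNReal.ofReal (r + 1) := by
          rw [← ENNReal.ofReal_coe_nnreal]; gcongr; simp
      _ ≤ _ := le_self_pow₀ h (by norm_num)
  · simpa [ENNReal.ofReal_toReal hu] using key u.toReal ENNReal.toReal_nonneg ENNReal.ofReal_toReal_le

/-- The `L²` inequality for the maximal function with bounded radii. -/
theorem lintegral_ballMax_sq_le {S : Set ℝ} {R : ℝ} (hS : ∀ r ∈ S, r ≤ R)
    {f : (Fin n → ℝ) → ℝ≥0∞} (hf : Measurable f) :
    ∫⁻ x, ballMax S f x ^ 2 ≤ 8 * 5 ^ n * ∫⁻ x, f x ^ 2 := by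
  have hM := measurable_ballMax S f
  have hlevel : ∀ t : ℝ, ENNReal.ofReal (2 * t) * volume {x | ENNReal.ofReal t < ballMax S f x} ≤
      4 * 5 ^ n * ∫⁻ x, {y | ENNReal.ofReal (t / 2) < f y}.indicator f x := by
    intro t
    have h4 : ENNReal.ofReal (2 * t) = 4 * ENNReal.ofReal (t / 2) := by
      rw [← ENNReal.ofReal_ofNat, ← ENNReal.ofReal_mul (by norm_num)]; ring_nf
    have h2 : ENNReal.ofReal t = ENNReal.ofReal (t / 2) + ENNReal.ofReal (t / 2) := by
      rw [← two_mul, ← ENNReal.ofReal_ofNat, ← ENNReal.ofReal_mul (by norm_num)]; ring_nf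
    rw [h4, mul_assoc, mul_assoc]
    refine mul_le_mul_right ?_ 4
    refine le_trans ?_ (mul_volume_lt_ballMax_le hS _ (ENNReal.ofReal (t / 2)))
    refine mul_le_mul_right (measure_mono fun x h => ?_) _
    have := (show ENNReal.ofReal t < ballMax S f x from h).trans_le (ballMax_le_ballMax_indicator_add S f (ENNReal.ofReal (t / 2)) x)
    rw [h2] at this
    exact lt_of_add_lt_add_right this
  calc ∫⁻ x, ballMax S f x ^ 2
      ≤ ∫⁻ x, ∫⁻ t in Set.Ioi (0 : ℝ), {t : ℝ | ENNReal.ofReal t < ballMax S f x}.indicator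
          (fun t => ENNReal.ofReal (2 * t)) t :=
        lintegral_mono fun x => ENNReal.sq_le_lintegral_indicator_Ioi _
    _ = ∫⁻ t in Set.Ioi (0 : ℝ), ∫⁻ x, {t : ℝ | ENNReal.ofReal t < ballMax S f x}.indicator
          (fun t => ENNReal.ofReal (2 * t)) t := by
        refine lintegral_lintegral_swap (Measurable.aemeasurable ?_)
        have : MeasurableSet {q : (Fin n → ℝ) × ℝ | ENNReal.ofReal q.2 < ballMax S f q.1} :=
          measurableSet_lt (by fun_prop) (by fun_prop)
        exact Measurable.indicator (f := fun q : (Fin n → ℝ) × ℝ => ENNReal.ofReal (2 * q.2))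
          (by fun_prop) this
    _ = ∫⁻ t in Set.Ioi (0 : ℝ),
          ENNReal.ofReal (2 * t) * volume {x | ENNReal.ofReal t < ballMax S f x} := by
        refine lintegral_congr fun t => ?_
        rw [← lintegral_indicator_const (measurableSet_lt measurable_const hM)]
        rfl
    _ ≤ ∫⁻ t in Set.Ioi (0 : ℝ),
          4 * 5 ^ n * ∫⁻ x, {y | ENNReal.ofReal (t / 2) < f y}.indicator f x :=
        lintegral_mono hlevel
    _ = 4 * 5 ^ n * ∫⁻ t in Set.Ioi (0 : ℝ),
          ∫⁻ x, {y | ENNReal.ofReal (t / 2) < f y}.indicator f x :=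
        lintegral_const_mul' _ _ (by finiteness)
    _ = 4 * 5 ^ n * ∫⁻ x, ∫⁻ t in Set.Ioi (0 : ℝ),
          {y | ENNReal.ofReal (t / 2) < f y}.indicator f x := by
        congr 1
        refine lintegral_lintegral_swap (Measurable.aemeasurable ?_)
        have : MeasurableSet {q : ℝ × (Fin n → ℝ) | ENNReal.ofReal (q.1 / 2) < f q.2} :=
          measurableSet_lt (by fun_prop) (by fun_prop)
        exact Measurable.indicator (f := fun q : ℝ × (Fin n → ℝ) => f q.2) (by fun_prop) this
    _ ≤ 4 * 5 ^ n * ∫⁻ x, 2 * f x ^ 2 := by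
        gcongr with x
        calc ∫⁻ t in Set.Ioi (0 : ℝ), {y | ENNReal.ofReal (t / 2) < f y}.indicator f x
            = f x * volume ({t : ℝ | ENNReal.ofReal (t / 2) < f x} ∩ Set.Ioi 0) := by
              have hm : MeasurableSet {t : ℝ | ENNReal.ofReal (t / 2) < f x} :=
                measurableSet_lt (by fun_prop) measurable_const
              rw [← Measure.restrict_apply hm, ← lintegral_indicator_const hm]
              rfl
          _ ≤ f x * (2 * f x) := by
              gcongr
              rcases eq_or_ne (f x) ∞ with h | h
              · simp [h]
              calc volume ({t : ℝ | ENNReal.ofReal (t / 2) < f x} ∩ Set.Ioi 0)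
                  ≤ volume (Set.Ioo 0 (2 * (f x).toReal)) := by
                    refine measure_mono fun t ht => ⟨ht.2, ?_⟩
                    have := (ENNReal.ofReal_lt_iff_lt_toReal (half_pos ht.2).le h).1 ht.1
                    linarith
                _ = 2 * f x := by
                    rw [Real.volume_Ioo, sub_zero, ENNReal.ofReal_mul (by norm_num),
                      ENNReal.ofReal_toReal h, ENNReal.ofReal_ofNat]
          _ = 2 * f x ^ 2 := by ring
    _ = 8 * 5 ^ n * ∫⁻ x, f x ^ 2 := by
        rw [lintegral_const_mul' _ _ (by finiteness), ← mul_assoc]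
        ring

end MaximalInequality

section Muckenhoupt

variable {n : ℕ}

theorem isCube_iff_exists_closedBall {Q : Set (Fin n → ℝ)} :
    IsCube Q ↔ ∃ (c : Fin n → ℝ) (r : ℝ), 0 < r ∧ Q = Metric.closedBall c r := by
  constructor
  · rintro ⟨a, l, hl, rfl⟩
    refine ⟨fun i => a i + l / 2, l / 2, half_pos hl, ?_⟩
    rw [closedBall_pi _ (half_pos hl).le]
    simp only [Real.closedBall_eq_Icc, add_sub_cancel_right, add_assoc, add_halves]
  · rintro ⟨c, r, hr, rfl⟩
    refine ⟨fun i => c i - r, 2 * r, by positivity, ?_⟩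
    rw [closedBall_pi _ hr.le]
    simp only [Real.closedBall_eq_Icc, sub_add_eq_add_sub, two_mul, ← add_assoc,
      add_sub_cancel_right]

theorem ballMax_le_maximal (f : (Fin n → ℝ) → ℝ) (x : Fin n → ℝ) :
    ballMax Set.univ (fun y => ENNReal.ofReal |f y|) x ≤ maximal Set.univ f x :=
  ballMax_le_iff.2 fun c r _ hr hx =>
    le_iSup_of_le (Metric.closedBall c r) <|
      le_iSup_of_le (isCube_iff_exists_closedBall.2 ⟨c, r, hr, rfl⟩) <|
        le_iSup_of_le (Set.subset_univ _) <|
          le_iSup_of_le (Metric.ball_subset_closedBall hx) le_rfl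

theorem ballAvg_le_mul_ballAvg (f : (Fin n → ℝ) → ℝ≥0∞) (c : Fin n → ℝ) {k r : ℝ}
    (hk : 1 ≤ k) (hr : 0 < r) :
    ballAvg f c r ≤ ENNReal.ofReal k ^ n * ballAvg f c (k * r) := by
  have hk0 : 0 < k := one_pos.trans_le hk
  have ha : ENNReal.ofReal k ^ n ≠ 0 := pow_ne_zero _ (by simpa using hk0)
  have ha' : ENNReal.ofReal k ^ n ≠ ∞ := by finiteness
  rw [ballAvg, ballAvg, volume_closedBall_mul c c hk0.le hr.le,
    ENNReal.mul_inv (Or.inl ha) (Or.inl ha'), mul_assoc, ← mul_assoc (ENNReal.ofReal k ^ n),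
    ENNReal.mul_inv_cancel ha ha', one_mul]
  gcongr
  exact le_mul_of_one_le_left hr.le hk

theorem ballAvg_congr {f g : (Fin n → ℝ) → ℝ≥0∞} {c : Fin n → ℝ} {r : ℝ}
    (h : ∀ y ∈ Metric.closedBall c r, f y = g y) : ballAvg f c r = ballAvg g c r := by
  rw [ballAvg, ballAvg, setLIntegral_congr_fun measurableSet_closedBall h]

/-- If the mean values of `v` are controlled by those of its square root, then its maximal function
satisfies the `A₁` condition. -/
theorem ballAvg_ballMax_le {v : (Fin n → ℝ) → ℝ≥0∞} (hv : Measurable v) {C : ℝ≥0∞} (hC : C ≠ ∞)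
    (h : ∀ c r, 0 < r → ballAvg v c r ≤ C * ballAvg (fun y => v y ^ (1 / 2 : ℝ)) c r ^ 2)
    {c x : Fin n → ℝ} {r : ℝ} (hr : 0 < r) (hx : x ∈ Metric.closedBall c r) :
    ballAvg (ballMax Set.univ v) c r ≤
      (C * (8 * 5 ^ n) * 3 ^ n + 4 ^ n) * ballMax Set.univ v x := by
  set M := ballMax Set.univ v x
  set B := Metric.closedBall c (3 * r)
  set g : (Fin n → ℝ) → ℝ≥0∞ := B.indicator fun y => v y ^ (1 / 2 : ℝ)
  set L := ballMax (Set.Iic r) g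
  have hg : Measurable g := (hv.pow_const _).indicator measurableSet_closedBall
  have hpt : ∀ y ∈ Metric.closedBall c r, ballMax Set.univ v y ≤ C * L y ^ 2 + 4 ^ n * M := by
    intro y hy
    refine ballMax_le_iff.2 fun c' r' _ hr' hyc => ?_
    rw [Metric.mem_closedBall] at hx hy
    rw [Metric.mem_ball] at hyc
    rcases le_or_gt r' r with hle | hlt
    · refine le_add_right ((h c' r' hr').trans ?_)
      gcongr
      rw [ballAvg_congr (g := g)]
      · exact ballAvg_le_ballMax g hle hr' hyc
      · intro z hz
        have hzB : z ∈ B := by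
          rw [Metric.mem_closedBall] at hz
          refine Metric.mem_closedBall.2 ?_
          linarith [dist_triangle z c' y, dist_triangle z y c, dist_comm y c']
        simp only [g, Set.indicator_of_mem hzB]
    · refine le_add_left ((ballAvg_le_mul_ballAvg v c' (k := 4) (by norm_num) hr').trans ?_)
      rw [ENNReal.ofReal_ofNat]
      gcongr
      refine ballAvg_le_ballMax v (Set.mem_univ _) (by positivity) ?_
      rw [Metric.mem_ball]
      linarith [dist_triangle x c c', dist_triangle c y c', dist_comm c y]
  have hL : ∫⁻ y in Metric.closedBall c r, L y ^ 2 ≤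
      8 * 5 ^ n * 3 ^ n * (volume (Metric.closedBall c r) * M) := by
    calc ∫⁻ y in Metric.closedBall c r, L y ^ 2 ≤ ∫⁻ y, L y ^ 2 := setLIntegral_le_lintegral _ _
      _ ≤ 8 * 5 ^ n * ∫⁻ y, g y ^ 2 := lintegral_ballMax_sq_le (R := r) (fun _ h => h) hg
      _ = 8 * 5 ^ n * ∫⁻ y in B, v y := by
          rw [← lintegral_indicator (s := B) measurableSet_closedBall]
          congr 2 with y
          by_cases hy : y ∈ B
          · simp only [g, Set.indicator_of_mem hy, ← ENNReal.rpow_natCast, ← ENNReal.rpow_mul]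
            norm_num
          · simp [g, Set.indicator_of_notMem hy]
      _ = 8 * 5 ^ n * (3 ^ n * volume (Metric.closedBall c r) * ballAvg v c (3 * r)) := by
          rw [← volume_mul_ballAvg v c (by positivity : 0 < 3 * r),
            volume_closedBall_mul c c (by norm_num) hr.le, ENNReal.ofReal_ofNat]
      _ ≤ 8 * 5 ^ n * (3 ^ n * volume (Metric.closedBall c r) * M) := by
          gcongr
          refine ballAvg_le_ballMax v (Set.mem_univ _) (by positivity) ?_
          rw [Metric.mem_closedBall] at hx
          rw [Metric.mem_ball]
          linarith
      _ = _ := by ring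
  calc ballAvg (ballMax Set.univ v) c r
      ≤ (volume (Metric.closedBall c r))⁻¹ *
          ∫⁻ y in Metric.closedBall c r, (C * L y ^ 2 + 4 ^ n * M) := by
        rw [ballAvg]
        refine mul_le_mul_right ?_ _
        exact setLIntegral_mono' measurableSet_closedBall hpt
    _ ≤ (volume (Metric.closedBall c r))⁻¹ *
          (C * (8 * 5 ^ n * 3 ^ n * (volume (Metric.closedBall c r) * M)) +
            4 ^ n * M * volume (Metric.closedBall c r)) := by
        rw [lintegral_add_right _ measurable_const, setLIntegral_const,
          lintegral_const_mul' _ _ hC]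
        gcongr
    _ = (volume (Metric.closedBall c r))⁻¹ * volume (Metric.closedBall c r) *
          ((C * (8 * 5 ^ n) * 3 ^ n + 4 ^ n) * M) := by ring
    _ = _ := by
        rw [ENNReal.inv_mul_cancel (volume_closedBall_ne_zero c hr)
          (volume_closedBall_ne_top c r), one_mul]

/-- The mean values of an `A_p` weight are controlled by those of its square root. -/
theorem MemApGT1.ballAvg_le {p : ℝ} (hp : 1 < p) {w : (Fin n → ℝ) → ℝ}
    (hw : MemApGT1 Set.univ p w) :
    ∃ C : ℝ≥0∞, C ≠ ∞ ∧ ∀ c r, 0 < r → ballAvg (fun y => ENNReal.ofReal (w y)) c r ≤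
      C * ballAvg (fun y => ENNReal.ofReal (w y) ^ (1 / 2 : ℝ)) c r ^ 2 := by
  obtain ⟨hwt, C, hC, hAp⟩ := hw
  refine ⟨C, hC, fun c r hr => ?_⟩
  specialize hAp _ (isCube_iff_exists_closedBall.2 ⟨c, r, hr, rfl⟩) (Set.subset_univ _)
  set q : ℝ := 1 - p / (p - 1)
  have hp1 : 0 < p - 1 := sub_pos.2 hp
  set D := ballAvg (fun y => ENNReal.ofReal (w y) ^ (1 / 2 : ℝ)) c r
  change ballAvg (fun y => ENNReal.ofReal (w y)) c r *
    ballAvg (fun y => ENNReal.ofReal (w y ^ q)) c r ^ (p - 1) ≤ C at hAp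
  set A := ballAvg (fun y => ENNReal.ofReal (w y)) c r
  set B := ballAvg (fun y => ENNReal.ofReal (w y ^ q)) c r
  have hpos : ∀ᵐ y ∂volume.restrict (Metric.closedBall c r), 0 < w y := by
    have := hwt.pos
    rw [Measure.restrict_univ] at this
    exact ae_restrict_of_ae this
  have hwm := hwt.measurable
  have hHolder : 1 ≤ D ^ (2 / (p + 1)) * B ^ ((p - 1) / (p + 1)) := by
    let μ : Measure (Fin n → ℝ) :=
      (volume (Metric.closedBall c r))⁻¹ • volume.restrict (Metric.closedBall c r)
    have hμ : ∀ f : (Fin n → ℝ) → ℝ≥0∞, ∫⁻ y, f y ∂μ = ballAvg f c r := fun f => by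
      rw [lintegral_smul_measure]; rfl
    have h1 : ∫⁻ _, 1 ∂μ = 1 := by
      rw [hμ, ballAvg, setLIntegral_one, ENNReal.inv_mul_cancel (volume_closedBall_ne_zero c hr)
          (volume_closedBall_ne_top c r)]
    have hμpos : ∀ᵐ y ∂μ, 0 < w y := Measure.ae_smul_measure hpos _
    calc 1 = ∫⁻ y, (ENNReal.ofReal (w y) ^ (1 / 2 : ℝ)) ^ (2 / (p + 1)) *
          ENNReal.ofReal (w y ^ q) ^ ((p - 1) / (p + 1)) ∂μ := by
          rw [← h1]
          refine lintegral_congr_ae ?_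
          filter_upwards [hμpos] with y hy
          have hy' : ENNReal.ofReal (w y) ≠ 0 := by simpa using hy
          rw [← ENNReal.ofReal_rpow_of_pos hy, ← ENNReal.rpow_mul, ← ENNReal.rpow_mul,
            ← ENNReal.rpow_add _ _ hy' ENNReal.ofReal_ne_top]
          have : 1 / 2 * (2 / (p + 1)) + q * ((p - 1) / (p + 1)) = 0 := by
            simp only [q]
            have : p + 1 ≠ 0 := by linarith
            field_simp
            ring
          rw [this, ENNReal.rpow_zero]
      _ ≤ (∫⁻ y, ENNReal.ofReal (w y) ^ (1 / 2 : ℝ) ∂μ) ^ (2 / (p + 1)) *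
          (∫⁻ y, ENNReal.ofReal (w y ^ q) ∂μ) ^ ((p - 1) / (p + 1)) := by
          refine ENNReal.lintegral_mul_norm_pow_le (by fun_prop) (by fun_prop) (by positivity)
            (by positivity) ?_
          have : p + 1 ≠ 0 := by linarith
          field_simp
          ring
      _ = _ := by rw [hμ, hμ]
  have hDB : 1 ≤ D ^ 2 * B ^ (p - 1) := by
    have hp2 : (0 : ℝ) < p + 1 := by linarith
    have := ENNReal.rpow_le_rpow hHolder hp2.le
    rwa [ENNReal.one_rpow, ENNReal.mul_rpow_of_nonneg _ _ hp2.le, ← ENNReal.rpow_mul,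
      ← ENNReal.rpow_mul, div_mul_cancel₀ _ hp2.ne', div_mul_cancel₀ _ hp2.ne',
      ENNReal.rpow_ofNat] at this
  calc A ≤ A * (D ^ 2 * B ^ (p - 1)) := le_mul_of_one_le_right' hDB
    _ = A * B ^ (p - 1) * D ^ 2 := by ring
    _ ≤ C * D ^ 2 := by gcongr

theorem IsWeight.ae_ofReal_le_ballMax {w : (Fin n → ℝ) → ℝ} (hw : IsWeight Set.univ w) :
    ∀ᵐ x, ENNReal.ofReal (w x) ≤ ballMax Set.univ (fun y => ENNReal.ofReal |w y|) x := by
  have hwint : ∀ c r, 0 < r → IntegrableOn w (Metric.closedBall c r) := fun c r hr =>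
    hw.locInt _ (isCube_iff_exists_closedBall.2 ⟨c, r, hr, rfl⟩) (Set.subset_univ _)
  have hloc : LocallyIntegrable w := fun x =>
    ⟨_, Metric.closedBall_mem_nhds x one_pos, hwint x 1 one_pos⟩
  filter_upwards [IsUnifLocDoublingMeasure.ae_tendsto_average volume hloc 1] with x hx
  have hlim := hx (fun _ : ℝ => x) (fun r => r) Filter.tendsto_id <| by
    filter_upwards [self_mem_nhdsWithin] with r hr
    exact Metric.mem_closedBall_self (by simpa using (Set.mem_Ioi.1 hr).le)
  refine le_of_tendsto (ENNReal.continuous_ofReal.continuousAt.tendsto.comp hlim) ?_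
  filter_upwards [self_mem_nhdsWithin] with r hr
  rw [Set.mem_Ioi] at hr
  refine le_trans ?_ (ballAvg_le_ballMax _ (Set.mem_univ r) hr (Metric.mem_ball_self hr))
  calc ENNReal.ofReal (⨍ y in Metric.closedBall x r, w y)
      ≤ ENNReal.ofReal (⨍ y in Metric.closedBall x r, |w y|) := by
        refine ENNReal.ofReal_le_ofReal ?_
        rw [setAverage_eq, setAverage_eq]
        refine smul_le_smul_of_nonneg_left ?_ (by positivity)
        exact integral_mono (hwint x r hr) (hwint x r hr).abs fun y => le_abs_self _
    _ = ballAvg (fun y => ENNReal.ofReal |w y|) x r := by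
        rw [ofReal_setAverage (hwint x r hr).abs (Filter.Eventually.of_forall fun y => abs_nonneg _),
          ballAvg, div_eq_mul_inv, mul_comm]

theorem MemApGT1.exists_memA1_majorant {p : ℝ} (hp : 1 < p) {w : (Fin n → ℝ) → ℝ}
    (hw : MemApGT1 Set.univ p w) (hfin : ∀ᵐ x, maximal Set.univ w x < ⊤) :
    ∃ u, MemA1 Set.univ u ∧ ∀ᵐ x, w x ≤ u x := by
  set v : (Fin n → ℝ) → ℝ≥0∞ := fun y => ENNReal.ofReal |w y|
  set M := ballMax Set.univ v
  have hwpos : ∀ᵐ x, 0 < w x := by simpa using hw.1.pos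
  have hvw : (fun y => ENNReal.ofReal (w y)) =ᵐ[volume] v := by
    filter_upwards [hwpos] with x hx
    simp only [v, abs_of_pos hx]
  have hMtop : ∀ᵐ x, M x < ∞ := by
    filter_upwards [hfin] with x hx using (ballMax_le_maximal w x).trans_lt hx
  have hwM := hw.1.ae_ofReal_le_ballMax
  have hMm : Measurable M := measurable_ballMax _ _
  have hv : Measurable v := by
    have := hw.1.measurable
    fun_prop
  obtain ⟨C, hC, hCw⟩ := hw.ballAvg_le hp
  have hCv : ∀ c r, 0 < r → ballAvg v c r ≤ C * ballAvg (fun y => v y ^ (1 / 2 : ℝ)) c r ^ 2 := by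
    intro c r hr
    convert hCw c r hr using 1
    · unfold ballAvg
      rw [setLIntegral_congr_fun_ae measurableSet_closedBall]
      filter_upwards [hvw] with y hy _ using hy.symm
    · unfold ballAvg
      rw [setLIntegral_congr_fun_ae measurableSet_closedBall]
      filter_upwards [hvw] with y hy _
      rw [← hy]
  have hA1 := fun c x r => ballAvg_ballMax_le hv hC hCv (c := c) (x := x) (r := r)
  set K : ℝ≥0∞ := C * (8 * 5 ^ n) * 3 ^ n + 4 ^ n
  have hK : K ≠ ∞ := by finiteness
  have habs : ∀ y, ENNReal.ofReal |(M y).toReal| ≤ M y := fun y => by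
    rw [abs_of_nonneg ENNReal.toReal_nonneg]
    exact ENNReal.ofReal_toReal_le
  refine ⟨fun x => (M x).toReal, ⟨⟨hMm.ennreal_toReal, ?_, ?_⟩, K.toReal, ?_⟩, ?_⟩
  · rw [Measure.restrict_univ]
    filter_upwards [hwpos, hMtop, hwM] with x h1 h2 h3
    exact ENNReal.toReal_pos ((ENNReal.ofReal_pos.2 h1).trans_le h3).ne' h2.ne
  · intro Q hQ _
    obtain ⟨c, r, hr, rfl⟩ := isCube_iff_exists_closedBall.1 hQ
    obtain ⟨x, hxQ, hx⟩ : ∃ x ∈ Metric.closedBall c r, M x < ∞ :=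
      ((frequently_ae_mem_iff.2 (volume_closedBall_ne_zero c hr)).and_eventually hMtop).exists
    have hlt : ballAvg M c r < ∞ :=
      (hA1 c x r hr hxQ).trans_lt (ENNReal.mul_lt_top hK.lt_top hx)
    refine integrable_toReal_of_lintegral_ne_top hMm.aemeasurable ?_
    rw [← volume_mul_ballAvg M c hr]
    exact ENNReal.mul_ne_top (volume_closedBall_ne_top c r) hlt.ne
  · rw [Measure.restrict_univ]
    filter_upwards [hMtop] with x hx
    rw [ENNReal.ofReal_mul ENNReal.toReal_nonneg, ENNReal.ofReal_toReal hK,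
      ENNReal.ofReal_toReal hx.ne]
    refine iSup_le fun Q => iSup_le fun hQ => iSup_le fun _ => iSup_le fun hxQ => ?_
    obtain ⟨c, r, hr, rfl⟩ := isCube_iff_exists_closedBall.1 hQ
    refine le_trans ?_ (hA1 c x r hr hxQ)
    unfold ballAvg
    gcongr with y
    exact habs y
  · filter_upwards [hMtop, hwM] with x h1 h2
    exact (ENNReal.ofReal_le_iff_le_toReal h1.ne).1 h2

end Muckenhoupt

theorem stmt6 (n : ℕ) :
    {f : (Fin n → ℝ) → ℝ | HasApMajorant Set.univ 1 f} =
      {f | Measurable f ∧ ∃ w, MemAInf Set.univ w ∧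
        (∀ᵐ x, maximal Set.univ w x < ⊤) ∧ ∀ᵐ x, |f x| ≤ w x} := by
  ext f
  constructor
  · rintro ⟨hf, w, hw, hfw⟩
    rw [Measure.restrict_univ] at hfw
    refine ⟨hf, w, ⟨1, le_rfl, hw⟩, ?_, hfw⟩
    obtain ⟨-, -, C, hC⟩ := hw.resolve_right fun h => lt_irrefl _ h.1
    rw [Measure.restrict_univ] at hC
    filter_upwards [hC] with x hx using hx.trans_lt ENNReal.ofReal_lt_top
  · rintro ⟨hf, w, ⟨p, -, ⟨rfl, hw⟩ | ⟨hp, hw⟩⟩, hfin, hfw⟩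
    · exact ⟨hf, w, Or.inl ⟨rfl, hw⟩, by rwa [Measure.restrict_univ]⟩
    · obtain ⟨u, hu, hwu⟩ := hw.exists_memA1_majorant hp hfin
      refine ⟨hf, u, Or.inl ⟨rfl, hu⟩, ?_⟩
      rw [Measure.restrict_univ]
      filter_upwards [hfw, hwu] with x h1 h2 using h1.trans h2
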